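/- Let 0 < α be sufficiently small and let r be a positive integer. For all sufficiently large m the following holds with n = mr. Suppose G[U,V] is a balanced bipartite graph on 2n vertices such that δ(G) = n/2 + C, where 0 ≤ C ≤ 3r/2, and such that the deletion of any edge of G results in a graph with minimum degree less than n/2 + C. Suppose there exist U₁′ ⊆ U and V₂′ ⊆ V with |U₁′| = |V₂′| = ⌊n/2⌋ and d(U₁′, V₂′) ≤ α, and set U₂′ = U∖U₁′ and V₁′ = V∖V₂′. Then d(U₂′, V₁′) ≤ 5√α. -/

import Mathlib

open scoped Classical
open Finset

namespace PaperTiling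

variable {V : Type*} [Fintype V] [DecidableEq V]

/-- The number of neighbours of `v` inside the set `S`. -/
noncomputable def degS (G : SimpleGraph V) (v : V) (S : Finset V) : ℕ :=
  (S.filter fun w => G.Adj v w).card

/-- The number of edges of `G` with one end in `A` and the other in `B`. -/
noncomputable def eAB (G : SimpleGraph V) (A B : Finset V) : ℕ :=
  ∑ v ∈ A, degS G v B

/-- The edge density `d(A,B) = e(A,B)/(|A||B|)`. -/
noncomputable def dens (G : SimpleGraph V) (A B : Finset V) : ℝ :=
  (eAB G A B : ℝ) / ((A.card : ℝ) * (B.card : ℝ))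

/-- `G` is a bipartite graph with parts `A` and `B`. -/
def IsBipartition (G : SimpleGraph V) (A B : Finset V) : Prop :=
  Disjoint A B ∧ A ∪ B = Finset.univ ∧
    ∀ u v : V, G.Adj u v → (u ∈ A ∧ v ∈ B) ∨ (u ∈ B ∧ v ∈ A)

/-- `(S, T)` spans a copy of the complete bipartite graph `K_{s,t}` in `G`,
with `S` the side of size `s` and `T` the side of size `t`. -/
def IsKst (G : SimpleGraph V) (s t : ℕ) (S T : Finset V) : Prop :=
  Disjoint S T ∧ S.card = s ∧ T.card = t ∧ ∀ u ∈ S, ∀ v ∈ T, G.Adj u v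

/-- `𝒯` is a perfect `K_{s,t}`-tiling of `G`: a collection of pairwise
vertex-disjoint copies of `K_{s,t}` covering all vertices. -/
def IsKstTiling (G : SimpleGraph V) (s t : ℕ)
    (𝒯 : Finset (Finset V × Finset V)) : Prop :=
  (∀ P ∈ 𝒯, IsKst G s t P.1 P.2) ∧
  (𝒯 : Set (Finset V × Finset V)).PairwiseDisjoint (fun P => P.1 ∪ P.2) ∧
  𝒯.sup (fun P => P.1 ∪ P.2) = Finset.univ

/-- `G` can be tiled with `K_{s,t}`. -/
def KstTileable (G : SimpleGraph V) (s t : ℕ) : Prop :=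
  ∃ 𝒯 : Finset (Finset V × Finset V), IsKstTiling G s t 𝒯

/-- `G` can be tiled with the complete graph `K_s`. -/
def CliqueTileable (G : SimpleGraph V) (s : ℕ) : Prop :=
  ∃ 𝒞 : Finset (Finset V),
    (∀ S ∈ 𝒞, S.card = s ∧ G.IsClique (S : Set V)) ∧
    (𝒞 : Set (Finset V)).PairwiseDisjoint id ∧
    𝒞.sup id = Finset.univ

/-- The minimum degree of `G` equals the real number `c`. -/
def MinDegreeIs (G : SimpleGraph V) (c : ℝ) : Prop :=
  (∀ v : V, c ≤ (degS G v Finset.univ : ℝ)) ∧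
  ∃ v : V, (degS G v Finset.univ : ℝ) = c

/-- `(c, L)` is an `h`-star with centre `c ∈ A` and `h` leaves `L ⊆ B`. -/
def IsStar (G : SimpleGraph V) (h : ℕ) (A B : Finset V) (c : V) (L : Finset V) : Prop :=
  c ∈ A ∧ L ⊆ B ∧ L.card = h ∧ ∀ v ∈ L, G.Adj c v

/-- `𝒮` is a family of pairwise vertex-disjoint `h`-stars from `A` to `B`. -/
def StarFamily (G : SimpleGraph V) (h : ℕ) (A B : Finset V)
    (𝒮 : Finset (V × Finset V)) : Prop :=
  (∀ S ∈ 𝒮, IsStar G h A B S.1 S.2) ∧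
  (𝒮 : Set (V × Finset V)).PairwiseDisjoint (fun S => insert S.1 S.2)

/-- The structure hypotheses (H) for the extremal construction of the paper:
`1 ≤ s < t`, `t ≥ 2s+1`, `k ≥ 1`, `G` is bipartite with parts
`U₀ ∪ U₁ ∪ U₂` and `V₀ ∪ V₁ ∪ V₂`, with the prescribed part sizes,
complete pairs `(U₁,V₁)`, `(U₂,V₂)`, `(U₀, V₁∪V₂)`, `(V₀, U₁∪U₂)`,
no edges between `U₀` and `V₀`, and sparse `K_{2,2}`-free diagonal pairs. -/
structure StructH (G : SimpleGraph V) (s t k : ℕ)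
    (U0 U1 U2 V0 V1 V2 : Finset V) : Prop where
  hs : 1 ≤ s
  hst : s < t
  ht : 2 * s + 1 ≤ t
  hk : 1 ≤ k
  bip : IsBipartition G (U0 ∪ U1 ∪ U2) (V0 ∪ V1 ∪ V2)
  hU01 : Disjoint U0 U1
  hU02 : Disjoint U0 U2
  hU12 : Disjoint U1 U2
  hV01 : Disjoint V0 V1
  hV02 : Disjoint V0 V2
  hV12 : Disjoint V1 V2
  cardU0 : U0.card = s - 1
  cardV0 : V0.card = s - 1
  cardU1 : U1.card = k * (s + t) + (t + 1) / 2
  cardV2 : V2.card = k * (s + t) + (t + 1) / 2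
  cardV1 : V1.card = k * (s + t) + (t + 2) / 2
  cardU2 : U2.card = k * (s + t) + (t + 2) / 2
  compU1V1 : ∀ u ∈ U1, ∀ v ∈ V1, G.Adj u v
  compU2V2 : ∀ u ∈ U2, ∀ v ∈ V2, G.Adj u v
  compU0 : ∀ u ∈ U0, ∀ v ∈ V1 ∪ V2, G.Adj u v
  compV0 : ∀ v ∈ V0, ∀ u ∈ U1 ∪ U2, G.Adj u v
  emptyU0V0 : ∀ u ∈ U0, ∀ v ∈ V0, ¬ G.Adj u v
  K22freeU1V2 : ∀ S T : Finset V, S ⊆ U1 → T ⊆ V2 → ¬ IsKst G 2 2 S T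
  K22freeU2V1 : ∀ S T : Finset V, S ⊆ U2 → T ⊆ V1 → ¬ IsKst G 2 2 S T
  degU1 : ∀ u ∈ U1, degS G u V2 ≤ s - 1
  degU2 : ∀ u ∈ U2, degS G u V1 ≤ s - 1
  degV1 : ∀ v ∈ V1, degS G v U2 ≤ s - 1
  degV2 : ∀ v ∈ V2, degS G v U1 ≤ s - 1

/-- The vertex set `W` of a copy of `K_{s,t}` is crossing. -/
def Crossing (U1 V1 U2 V2 W : Finset V) : Prop :=
  (W ∩ (U1 ∪ V1)).Nonempty ∧ (W ∩ (U2 ∪ V2)).Nonempty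

/-- `W` is crossing from the set `A`, where `AD = A^D` is the diagonal set of `A`
and `AM = A^M` is the opposite middle set of `A`. -/
def CrossingFrom (W A AD AM : Finset V) : Prop :=
  (W ∩ A).card = 1 ∧
    (2 ≤ (W ∩ AD).card ∨ ((W ∩ AD).card = 1 ∧ (W ∩ AM).Nonempty))

/-- `W` is of Type 1 (crossing from `A`), where `AD = A^D`, `AN = A^N`,
`ANM = (A^N)^M`. -/
def Type1From (s t : ℕ) (W AD AN ANM : Finset V) : Prop :=
  ∃ p : ℕ, 2 ≤ p ∧ p ≤ s - 1 ∧ (W ∩ ANM).card = s - 1 ∧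
    (W ∩ AN).card = t - p ∧ (W ∩ AD).card = p

/-- `W` is of Type 2 (crossing from `A`), where `AD = A^D`, `AM = A^M`,
`AND = (A^N)^D`. -/
def Type2From (s t : ℕ) (W AD AM AND : Finset V) : Prop :=
  ∃ p : ℕ, 1 ≤ p ∧ p ≤ s - 1 ∧ (W ∩ AND).card = t - 1 ∧
    (W ∩ AM).card = s - p ∧ (W ∩ AD).card = p

section EdgeCounts

variable {W : Type*} (G : SimpleGraph W)

lemma degS_add_degS_sdiff [DecidableEq W] (v : W) {S T : Finset W} (h : S ⊆ T) :
    degS G v S + degS G v (T \ S) = degS G v T := by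
  unfold degS
  rw [← Finset.card_union_of_disjoint, ← Finset.filter_union, Finset.union_sdiff_of_subset h]
  exact Finset.disjoint_filter_filter Finset.disjoint_sdiff

lemma degS_le_card (v : W) (S : Finset W) : degS G v S ≤ S.card :=
  Finset.card_filter_le _ _

lemma degS_mono (v : W) {S T : Finset W} (h : S ⊆ T) : degS G v S ≤ degS G v T :=
  Finset.card_le_card (Finset.filter_subset_filter _ h)

lemma degS_univ_eq [Fintype W] {v : W} {S : Finset W} (h : ∀ w, G.Adj v w → w ∈ S) :
    degS G v Finset.univ = degS G v S := by
  unfold degS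
  congr 1
  ext w
  simpa using h w

lemma eAB_comm (A B : Finset W) : eAB G A B = eAB G B A := by
  unfold eAB degS
  simp only [Finset.card_filter]
  rw [Finset.sum_comm]
  simp only [G.adj_comm]

lemma eAB_add_eAB_sdiff [DecidableEq W] {S T : Finset W} (h : S ⊆ T) (B : Finset W) :
    eAB G S B + eAB G (T \ S) B = eAB G T B := by
  unfold eAB
  rw [add_comm, Finset.sum_sdiff h]

lemma eAB_le_card_mul (A B : Finset W) : eAB G A B ≤ A.card * B.card := by
  unfold eAB
  simpa using Finset.sum_le_card_nsmul A _ B.card fun v _ => degS_le_card G v B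

lemma eAB_mono_right (A : Finset W) {S T : Finset W} (h : S ⊆ T) :
    eAB G A S ≤ eAB G A T :=
  Finset.sum_le_sum fun v _ => degS_mono G v h

/-- If the vertices of `X` have degree at least `D` into `Y ∪ Y'` but few edges go to `Y'`, then
`(X, Y)` is nearly complete, so the vertices of `L ⊆ Y` of degree `D` send few edges elsewhere. -/
lemma eAB_le_of_degree_eq [DecidableEq W] {X X' Y Y' L : Finset W} {D δ : ℝ} (hL : L ⊆ Y)
    (hX : ∀ x ∈ X, D ≤ (degS G x Y : ℝ) + degS G x Y')
    (hLD : ∀ y ∈ L, (degS G y X : ℝ) + degS G y X' = D)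
    (hδ : (eAB G X Y' : ℝ) ≤ δ) :
    (eAB G L X' : ℝ) ≤ L.card * (D - X.card) + δ + X.card * (Y.card - D) := by
  have h1 : (X.card : ℝ) * D ≤ eAB G X Y + eAB G X Y' := by
    have := Finset.card_nsmul_le_sum X _ D hX
    rw [Finset.sum_add_distrib, nsmul_eq_mul] at this
    simpa [eAB] using this
  have h2 : (eAB G L X : ℝ) + eAB G L X' = L.card * D := by
    have := Finset.sum_congr (rfl : L = L) hLD
    rw [Finset.sum_add_distrib, Finset.sum_const, nsmul_eq_mul] at this
    simpa [eAB] using this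
  have h3 : (eAB G X Y : ℝ) = eAB G L X + eAB G (Y \ L) X := by
    rw [eAB_comm G X Y, ← eAB_add_eAB_sdiff G hL X]
    push_cast
    ring
  have h4 : (eAB G (Y \ L) X : ℝ) ≤ (Y \ L).card * X.card := by
    exact_mod_cast eAB_le_card_mul G (Y \ L) X
  have h5 : ((Y \ L).card : ℝ) + L.card = Y.card := by
    exact_mod_cast Finset.card_sdiff_add_card_eq_card hL
  rw [← eq_sub_iff_add_eq] at h5
  rw [h5] at h4
  linarith

/-- If `L ⊆ X` and `M ⊆ Y` cover all edges between `X` and `Y`, then `e(X, Y)` is at most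
`e(L, Y) + e(M, X)`. -/
lemma eAB_le_add_of_cover [DecidableEq W] {X Y L M : Finset W} (hL : L ⊆ X) (hM : M ⊆ Y)
    (h : ∀ x ∈ X, ∀ y ∈ Y, G.Adj x y → x ∈ L ∨ y ∈ M) :
    eAB G X Y ≤ eAB G L Y + eAB G M X := by
  have h0 : eAB G (Y \ M) (X \ L) = 0 := by
    refine Finset.sum_eq_zero fun y hy => ?_
    rw [degS, Finset.card_eq_zero, Finset.filter_eq_empty_iff]
    intro x hx hxy
    rw [Finset.mem_sdiff] at hx hy
    rcases h x hx.1 y hy.1 hxy.symm with h | h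
    exacts [hx.2 h, hy.2 h]
  have h1 := eAB_add_eAB_sdiff G hL Y
  have h2 := eAB_add_eAB_sdiff G hM (X \ L)
  have h3 := eAB_mono_right G M (Finset.sdiff_subset : X \ L ⊆ X)
  rw [eAB_comm G (X \ L) Y] at h1
  omega

lemma degS_le_degS_deleteEdges_add_one (u v w : W) (S : Finset W) :
    degS G w S ≤ degS (G.deleteEdges {s(u, v)}) w S + 1 := by
  unfold degS
  by_cases hw : w = u
  · subst hw
    refine (Finset.card_le_card (t := insert v _) ?_).trans (Finset.card_insert_le _ _)
    intro x
    simp only [Finset.mem_filter, Finset.mem_insert, SimpleGraph.deleteEdges_adj,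
      Set.mem_singleton_iff, Sym2.eq_iff]
    grind
  · refine (Finset.card_le_card (t := insert u _) ?_).trans (Finset.card_insert_le _ _)
    intro x
    simp only [Finset.mem_filter, Finset.mem_insert, SimpleGraph.deleteEdges_adj,
      Set.mem_singleton_iff, Sym2.eq_iff]
    grind

lemma degS_deleteEdges_of_ne {u v w : W} (hu : w ≠ u) (hv : w ≠ v) (S : Finset W) :
    degS (G.deleteEdges {s(u, v)}) w S = degS G w S := by
  unfold degS
  congr 1
  ext x
  simp only [Finset.mem_filter, SimpleGraph.deleteEdges_adj, Set.mem_singleton_iff, Sym2.eq_iff]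
  grind

/-- In a graph that is edge-minimal with respect to its minimum degree `D`, every edge has an end
of degree `D`. -/
lemma MinDegreeIs.degS_eq_or_of_edge_minimal [Fintype W] {G : SimpleGraph W} {D : ℝ}
    (hD : MinDegreeIs G D) {u v : W}
    (h : ∃ w, (degS (G.deleteEdges {s(u, v)}) w Finset.univ : ℝ) < D) :
    (degS G u Finset.univ : ℝ) = D ∨ (degS G v Finset.univ : ℝ) = D := by
  obtain ⟨hmin, z, rfl⟩ := hD
  obtain ⟨w, hw⟩ := h
  have hwz : degS G w Finset.univ = degS G z Finset.univ := by
    have h1 := degS_le_degS_deleteEdges_add_one G u v w Finset.univ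
    have h2 := hmin w
    norm_cast at hw h2
    omega
  by_cases hu : w = u
  · subst hu
    exact Or.inl (by exact_mod_cast hwz)
  by_cases hv : w = v
  · subst hv
    exact Or.inr (by exact_mod_cast hwz)
  rw [degS_deleteEdges_of_ne G hu hv, hwz] at hw
  exact absurd hw (lt_irrefl _)

end EdgeCounts

/-- Claim 2.1: for sufficiently small `α > 0`, `r ≥ 1` and
sufficiently large `m`, if `G` is balanced bipartite on `2n = 2mr` vertices
with `δ(G) = n/2 + C` (`0 ≤ C ≤ 3r/2`), edge-minimal with respect to this
minimum degree, and extremal with parameter `α` via `U₁', V₂'`, then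
`d(U∖U₁', V∖V₂') ≤ 5√α`. -/
theorem claim_diagonals :
    ∃ α₀ : ℝ, 0 < α₀ ∧ ∀ α : ℝ, 0 < α → α ≤ α₀ →
    ∀ r : ℕ, 1 ≤ r →
    ∃ m₁ : ℕ, ∀ m : ℕ, m₁ ≤ m → ∀ n : ℕ, n = m * r →
    ∀ (V : Type) (_ : Fintype V) (_ : DecidableEq V),
    ∀ (G : SimpleGraph V) (A B : Finset V) (C : ℝ),
      IsBipartition G A B → A.card = n → B.card = n →
      0 ≤ C → C ≤ 3 * (r : ℝ) / 2 →
      MinDegreeIs G ((n : ℝ) / 2 + C) →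
      (∀ u v : V, G.Adj u v →
        ∃ w : V,
          (degS (G.deleteEdges {s(u, v)}) w Finset.univ : ℝ) < (n : ℝ) / 2 + C) →
      ∀ U₁' ⊆ A, ∀ V₂' ⊆ B,
        U₁'.card = n / 2 → V₂'.card = n / 2 → dens G U₁' V₂' ≤ α →
        dens G (A \ U₁') (B \ V₂') ≤ 5 * Real.sqrt α := by
  refine ⟨1, one_pos, fun α hα hα1 r hr => ?_⟩
  have hs : 0 < Real.sqrt α := Real.sqrt_pos.2 hα
  refine ⟨max 2 ⌈2 * ((r : ℝ) + 1) / Real.sqrt α⌉₊, ?_⟩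
  intro m hm n hn V _ _ G A B C hbip hA hB hC0 hC hD hedge U₁ hU₁ V₂ hV₂ hcU hcV hdens
  obtain ⟨hdisj, -, hadj⟩ := hbip
  have hm2 : 2 ≤ m := (le_max_left _ _).trans hm
  have hmα : 2 * ((r : ℝ) + 1) ≤ m * Real.sqrt α := by
    rw [← div_le_iff₀ hs]
    exact (Nat.le_ceil _).trans (by exact_mod_cast (le_max_right _ _).trans hm)
  have hmn : m ≤ n := hn ▸ Nat.le_mul_of_pos_right m hr
  obtain ⟨a, ha⟩ : ∃ a, a = n / 2 := ⟨_, rfl⟩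
  obtain ⟨b, hb⟩ : ∃ b, b = n - n / 2 := ⟨_, rfl⟩
  have hcU₂ : (A \ U₁).card = b := by rw [Finset.card_sdiff_of_subset hU₁, hA, hcU, hb]
  have hcV₁ : (B \ V₂).card = b := by rw [Finset.card_sdiff_of_subset hV₂, hB, hcV, hb]
  rw [← ha] at hcU hcV
  have ha1 : (1 : ℝ) ≤ a := by exact_mod_cast (by omega : 1 ≤ a)
  have hab : (a : ℝ) ≤ b := by exact_mod_cast (by omega : a ≤ b)
  have hba : (b : ℝ) ≤ a + 1 := by exact_mod_cast (by omega : b ≤ a + 1)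
  have habn : (a : ℝ) + b = n := by exact_mod_cast (by omega : a + b = n)
  have hmb : (m : ℝ) ≤ 2 * b := by exact_mod_cast (by omega : m ≤ 2 * b)
  have hAB : ∀ u ∈ A, degS G u Finset.univ = degS G u (B \ V₂) + degS G u V₂ := by
    intro u hu
    rw [add_comm, degS_add_degS_sdiff G u hV₂]
    refine degS_univ_eq G fun w hw => ?_
    rcases hadj u w hw with h | h
    exacts [h.2, absurd h.1 (Finset.disjoint_left.1 hdisj hu)]
  have hBA : ∀ v ∈ B, degS G v Finset.univ = degS G v (A \ U₁) + degS G v U₁ := by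
    intro v hv
    rw [add_comm, degS_add_degS_sdiff G v hU₁]
    refine degS_univ_eq G fun w hw => ?_
    rcases hadj v w hw with h | h
    exacts [absurd hv (Finset.disjoint_left.1 hdisj h.1), h.2]
  have hδ : (eAB G U₁ V₂ : ℝ) ≤ α * (a * a) := by
    rw [dens, hcU, hcV, div_le_iff₀ (by positivity)] at hdens
    exact hdens
  set D : ℝ := (n : ℝ) / 2 + C with hDdef
  let L := (A \ U₁).filter fun u => (degS G u Finset.univ : ℝ) = D
  let M := (B \ V₂).filter fun v => (degS G v Finset.univ : ℝ) = D
  have hLs : L ⊆ A \ U₁ := Finset.filter_subset _ _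
  have hMs : M ⊆ B \ V₂ := Finset.filter_subset _ _
  have hLc : (L.card : ℝ) ≤ b := by exact_mod_cast hcU₂ ▸ Finset.card_le_card hLs
  have hMc : (M.card : ℝ) ≤ b := by exact_mod_cast hcV₁ ▸ Finset.card_le_card hMs
  have hLe : (eAB G L (B \ V₂) : ℝ) ≤ L.card * (D - a) + α * (a * a) + a * (b - D) := by
    have := eAB_le_of_degree_eq G (X := V₂) (X' := B \ V₂) (Y' := U₁) (D := D)
      (δ := α * (a * a)) hLs
      (fun x hx => by have := hD.1 x; rw [hBA x (hV₂ hx)] at this; exact_mod_cast this)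
      (fun y hy => by
        obtain ⟨h1, h2⟩ := Finset.mem_filter.1 hy
        rw [hAB y (Finset.mem_sdiff.1 h1).1] at h2
        push_cast at h2
        linarith)
      (by rwa [eAB_comm])
    rwa [hcV, hcU₂] at this
  have hMe : (eAB G M (A \ U₁) : ℝ) ≤ M.card * (D - a) + α * (a * a) + a * (b - D) := by
    have := eAB_le_of_degree_eq G (X := U₁) (X' := A \ U₁) (Y' := V₂) (D := D) hMs
      (fun x hx => by have := hD.1 x; rw [hAB x (hU₁ hx)] at this; exact_mod_cast this)
      (fun y hy => by
        obtain ⟨h1, h2⟩ := Finset.mem_filter.1 hy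
        rw [hBA y (Finset.mem_sdiff.1 h1).1] at h2
        push_cast at h2
        linarith)
      hδ
    rwa [hcU, hcV₁] at this
  have htot : (eAB G (A \ U₁) (B \ V₂) : ℝ) ≤ eAB G L (B \ V₂) + eAB G M (A \ U₁) := by
    exact_mod_cast eAB_le_add_of_cover G hLs hMs fun x hx y hy hxy =>
      (hD.degS_eq_or_of_edge_minimal (hedge x y hxy)).imp
        (fun h => Finset.mem_filter.2 ⟨hx, h⟩) (fun h => Finset.mem_filter.2 ⟨hy, h⟩)
  rw [dens, hcU₂, hcV₁, div_le_iff₀ (mul_pos (by linarith) (by linarith))]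
  have hαs : α ≤ Real.sqrt α := Real.le_sqrt_of_sq_le (by nlinarith)
  have hDa : 0 ≤ D - a := by linarith
  have h1 : (L.card : ℝ) * (D - a) ≤ b * (D - a) := mul_le_mul_of_nonneg_right hLc hDa
  have h2 : (M.card : ℝ) * (D - a) ≤ b * (D - a) := mul_le_mul_of_nonneg_right hMc hDa
  have h3 : (b : ℝ) * (D - a) ≤ b * (3 * r / 2 + 1 / 2) :=
    mul_le_mul_of_nonneg_left (by linarith) (by linarith)
  have h4 : (a : ℝ) * (b - D) ≤ b * 1 :=
    (mul_le_mul_of_nonneg_left (by linarith) (by linarith)).trans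
      (mul_le_mul_of_nonneg_right hab zero_le_one)
  have h5 : α * ((a : ℝ) * a) ≤ Real.sqrt α * (b * b) := by gcongr
  have h6 : (r : ℝ) + 1 ≤ b * Real.sqrt α := by nlinarith
  have h7 : (b : ℝ) * (r + 1) ≤ b * (b * Real.sqrt α) :=
    mul_le_mul_of_nonneg_left h6 (by linarith)
  linarith

end PaperTiling
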